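/- arXiv:1401.7794 — 3 statements merged into one kernel-verified Lean document; each statement's English description precedes it below -/
import Mathlib

section
/- Let H be a real separable Hilbert space, let σ : H → H be measurable with |σ(z)|_H ≤ C(1 + |z|_H) for all z ∈ H and some constant C, and let f : H → ℝ be twice Fréchet differentiable with bounded and Lipschitz second derivative. Let ν be a σ-finite Borel measure on ℝ \ {0} with ∫_{0<|x|≤1} x² ν(dx) < ∞, set α(ε) = (∫_{0<|x|≤ε} x² ν(dx))^{1/2}, assume α(ε) > 0 for all ε ∈ (0,1] and that ε/α(ε) → 0 as ε → 0. Then for every N > 0, sup over z with |z|_H ≤ N of | ∫_{0<|x|≤ε} [ f(z + (x/α(ε))·σ(z)) − f(z) − f'(z)((x/α(ε))·σ(z)) ] ν(dx) − (1/2) f''(z)(σ(z), σ(z)) | converges to 0 as ε → 0; that is, the pure-jump generator L^ε f converges to the diffusion generator L f uniformly on bounded subsets of H. -/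
open MeasureTheory Filter Topology Set

/-- Second-order Taylor estimate for a function whose second derivative is Lipschitz. -/
theorem abs_sub_second_order_taylor_le {E : Type*} [NormedAddCommGroup E] [NormedSpace ℝ E]
    {f : E → ℝ} (hf : ContDiff ℝ 2 f) {K : NNReal}
    (hK : LipschitzWith K (fun z => fderiv ℝ (fderiv ℝ f) z)) (z h : E) :
    |f (z + h) - f z - fderiv ℝ f z h - (1 / 2) * fderiv ℝ (fderiv ℝ f) z h h| ≤ K * ‖h‖ ^ 3 := by
  have hf1 : Differentiable ℝ f := hf.differentiable (by norm_num)
  have hf2 : Differentiable ℝ (fderiv ℝ f) :=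
    (hf.fderiv_right (m := 1) (by norm_num)).differentiable (by norm_num)
  have first_order : ∀ v : E,
      ‖fderiv ℝ f (z + v) - fderiv ℝ f z - fderiv ℝ (fderiv ℝ f) z v‖ ≤ K * ‖v‖ * ‖v‖ := by
    intro v
    have := (convex_closedBall z ‖v‖).norm_image_sub_le_of_norm_fderiv_le'
      (f := fderiv ℝ f) (φ := fderiv ℝ (fderiv ℝ f) z) (C := K * ‖v‖) (x := z) (y := z + v)
      (fun x _ => hf2 x)
      (fun x hx => (hK.norm_sub_le x z).trans
        (mul_le_mul_of_nonneg_left (mem_closedBall_iff_norm.1 hx) K.2))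
      (by simp) (by simp)
    simpa using this
  have hderiv : ∀ t : ℝ, HasDerivAt
      (fun t : ℝ => f (z + t • h) - t * fderiv ℝ f z h
        - t ^ 2 / 2 * fderiv ℝ (fderiv ℝ f) z h h)
      (fderiv ℝ f (z + t • h) h - fderiv ℝ f z h - t * fderiv ℝ (fderiv ℝ f) z h h) t := by
    intro t
    have hline : HasDerivAt (fun t : ℝ => z + t • h) h t := by
      simpa using ((hasDerivAt_id t).smul_const h).const_add z
    have h1 := (hf1 (z + t • h)).hasFDerivAt.comp_hasDerivAt t hline
    have h2 := (hasDerivAt_id t).mul_const (fderiv ℝ f z h)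
    have h3 := (((hasDerivAt_id t).pow 2).div_const 2).mul_const (fderiv ℝ (fderiv ℝ f) z h h)
    refine ((h1.sub h2).sub h3).congr_deriv ?_
    simp
  have key := norm_image_sub_le_of_norm_deriv_le_segment_01' (C := K * ‖h‖ ^ 3)
    (fun t _ => (hderiv t).hasDerivWithinAt) (fun t ht => by
      have h1 := (fderiv ℝ f (z + t • h) - fderiv ℝ f z
        - fderiv ℝ (fderiv ℝ f) z (t • h)).le_of_opNorm_le (first_order (t • h)) h
      have h2 : ‖t • h‖ ≤ ‖h‖ := by
        rw [norm_smul, Real.norm_of_nonneg ht.1]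
        exact mul_le_of_le_one_left (norm_nonneg h) ht.2.le
      calc _ ≤ K * ‖t • h‖ * ‖t • h‖ * ‖h‖ := by simpa using h1
        _ ≤ K * ‖h‖ * ‖h‖ * ‖h‖ := by gcongr
        _ = K * ‖h‖ ^ 3 := by ring)
  refine le_trans (le_of_eq ?_) key
  rw [Real.norm_eq_abs]
  congr 1
  simp
  ring

/-- Convergence of the pure-jump generator to the diffusion generator
(Lemma 3.4 of the paper, jump part): with
`α(ε) = (∫_{0<|x|≤ε} x² ν(dx))^{1/2}` and `ε/α(ε) → 0` as `ε → 0`, for every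
`N > 0` the quantity
`| ∫_{0<|x|≤ε} [f(z + (x/α(ε))σ(z)) - f(z) - f'(z)((x/α(ε))σ(z))] ν(dx)
   - (1/2) f''(z)(σ(z), σ(z)) |`
tends to `0` as `ε → 0`, uniformly over `z` with `‖z‖ ≤ N`. -/
theorem generator_convergence_uniform_on_bounded_sets
    {H : Type*} [NormedAddCommGroup H] [InnerProductSpace ℝ H] [CompleteSpace H]
    [SecondCountableTopology H] [MeasurableSpace H] [BorelSpace H]
    (σ : H → H) (hσ_meas : Measurable σ)
    (C : ℝ) (hσ_growth : ∀ z : H, ‖σ z‖ ≤ C * (1 + ‖z‖))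
    (f : H → ℝ) (hf : ContDiff ℝ 2 f)
    (M : ℝ) (hf''_bdd : ∀ z : H, ‖fderiv ℝ (fderiv ℝ f) z‖ ≤ M)
    (K : NNReal) (hf''_lip : LipschitzWith K (fun z => fderiv ℝ (fderiv ℝ f) z))
    (ν : Measure ℝ) [SigmaFinite ν] (hν0 : ν {0} = 0)
    (hν_int : IntegrableOn (fun x : ℝ => x ^ 2) {x : ℝ | 0 < |x| ∧ |x| ≤ 1} ν)
    (α : ℝ → ℝ)
    (hα : ∀ ε : ℝ,
      α ε = Real.sqrt (∫ x in {x : ℝ | 0 < |x| ∧ |x| ≤ ε}, x ^ 2 ∂ν))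
    (hα_pos : ∀ ε ∈ Set.Ioc (0:ℝ) 1, 0 < α ε)
    (hα_lim : Tendsto (fun ε : ℝ => ε / α ε) (𝓝[>] (0:ℝ)) (𝓝 0)) :
    ∀ N : ℝ, 0 < N → ∀ δ : ℝ, 0 < δ → ∃ ε₀ : ℝ, 0 < ε₀ ∧
      ∀ ε : ℝ, 0 < ε → ε ≤ ε₀ → ∀ z : H, ‖z‖ ≤ N →
        |(∫ x in {x : ℝ | 0 < |x| ∧ |x| ≤ ε},
              (f (z + (x / α ε) • σ z) - f z - fderiv ℝ f z ((x / α ε) • σ z)) ∂ν)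
            - (1/2) * fderiv ℝ (fderiv ℝ f) z (σ z) (σ z)| < δ := by
  intro N hN δ hδ
  set S : ℝ := |C| * (1 + N) with hS
  have hS0 : 0 ≤ S := by positivity
  set B : ℝ := K * S ^ 3 with hB
  have hB0 : 0 ≤ B := by positivity
  have hsmall : ∀ᶠ ε in 𝓝[>] (0:ℝ), ε / α ε < δ / (B + 1) :=
    hα_lim.eventually (gt_mem_nhds (by positivity))
  obtain ⟨u, hu, hu_small⟩ := mem_nhdsGT_iff_exists_Ioc_subset.1 hsmall
  refine ⟨min u 1, lt_min hu one_pos, fun ε hε hεu z hz => ?_⟩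
  have hε1 : ε ≤ 1 := hεu.trans (min_le_right _ _)
  have hratio : ε / α ε < δ / (B + 1) := hu_small ⟨hε, hεu.trans (min_le_left _ _)⟩
  have ha : 0 < α ε := hα_pos ε ⟨hε, hε1⟩
  have hsq : ∫ x in {x : ℝ | 0 < |x| ∧ |x| ≤ ε}, x ^ 2 ∂ν = α ε ^ 2 := by
    rw [hα ε, Real.sq_sqrt (integral_nonneg fun x => sq_nonneg x)]
  set a := α ε
  set A : Set ℝ := {x : ℝ | 0 < |x| ∧ |x| ≤ ε} with hA
  have hA_meas : MeasurableSet A :=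
    (measurableSet_lt measurable_const measurable_norm).inter
      (measurableSet_le measurable_norm measurable_const)
  have hA_int : IntegrableOn (fun x : ℝ => x ^ 2) A ν :=
    hν_int.mono_set fun x hx => ⟨hx.1, hx.2.trans hε1⟩
  have hσ : ‖σ z‖ ≤ S := (hσ_growth z).trans <|
    mul_le_mul (le_abs_self C) (by linarith) (by positivity) (abs_nonneg C)
  set q := fderiv ℝ (fderiv ℝ f) z (σ z) (σ z) with hq
  set F : ℝ → ℝ := fun x =>
    f (z + (x / a) • σ z) - f z - fderiv ℝ f z ((x / a) • σ z) with hF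
  have hF_cont : Continuous F := by
    have := hf.continuous
    fun_prop
  have hbound : ∀ x ∈ A, ‖F x - q / (2 * a ^ 2) * x ^ 2‖ ≤ B * (ε / a) / a ^ 2 * x ^ 2 := by
    intro x hx
    have hT := abs_sub_second_order_taylor_le hf hf''_lip z ((x / a) • σ z)
    have hquad : (1 / 2) * fderiv ℝ (fderiv ℝ f) z ((x / a) • σ z) ((x / a) • σ z)
        = q / (2 * a ^ 2) * x ^ 2 := by
      simp only [map_smul, smul_apply, smul_eq_mul, ← hq]
      field_simp
    rw [hquad] at hT
    refine hT.trans ?_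
    have hn : ‖(x / a) • σ z‖ = |x| / a * ‖σ z‖ := by
      rw [norm_smul, Real.norm_eq_abs, abs_div, abs_of_pos ha]
    calc K * ‖(x / a) • σ z‖ ^ 3 = K * ‖σ z‖ ^ 3 * (|x| / a) / a ^ 2 * |x| ^ 2 := by
          rw [hn]; field_simp
      _ ≤ K * S ^ 3 * (ε / a) / a ^ 2 * |x| ^ 2 := by
          gcongr
          exact hx.2
      _ = B * (ε / a) / a ^ 2 * x ^ 2 := by rw [sq_abs]
  have hbound_ae : ∀ᵐ x ∂ν.restrict A,
      ‖F x - q / (2 * a ^ 2) * x ^ 2‖ ≤ B * (ε / a) / a ^ 2 * x ^ 2 :=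
    (ae_restrict_mem hA_meas).mono hbound
  have hquad_int : Integrable (fun x : ℝ => q / (2 * a ^ 2) * x ^ 2) (ν.restrict A) :=
    hA_int.const_mul _
  have hdom_int : Integrable (fun x : ℝ => B * (ε / a) / a ^ 2 * x ^ 2) (ν.restrict A) :=
    hA_int.const_mul _
  have hrem_int : Integrable (fun x => F x - q / (2 * a ^ 2) * x ^ 2) (ν.restrict A) :=
    hdom_int.mono' (by
      have : Continuous fun x => F x - q / (2 * a ^ 2) * x ^ 2 := by fun_prop
      exact this.aestronglyMeasurable) hbound_ae
  have hF_int : Integrable F (ν.restrict A) := by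
    refine (hrem_int.add hquad_int).congr (ae_of_all _ fun x => ?_)
    simp
  have hdiff : (∫ x in A, F x ∂ν) - (1 / 2) * q
      = ∫ x in A, (F x - q / (2 * a ^ 2) * x ^ 2) ∂ν := by
    rw [integral_sub hF_int hquad_int, integral_const_mul, hsq]
    field_simp
  rw [hdiff, ← Real.norm_eq_abs]
  calc _ ≤ ∫ x in A, B * (ε / a) / a ^ 2 * x ^ 2 ∂ν :=
        norm_integral_le_of_norm_le hdom_int hbound_ae
    _ = B * (ε / a) := by
        rw [integral_const_mul, hsq]
        field_simp
    _ ≤ (B + 1) * (ε / a) := by gcongr; linarith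
    _ < δ := by rwa [lt_div_iff₀' (by positivity)] at hratio
end

section
/- There exists a constant C such that for every continuously differentiable function u : [0,1] → ℝ with u(0) = u(1) = 0, ( ∑_{k=1}^∞ ( (1/(2kπ)) ∫₀¹ (u²)'(ξ) · √2·sin(kπξ) dξ )² )^{1/2} ≤ C ( ∫₀¹ u(ξ)² dξ )^{3/4} ( ∫₀¹ u'(ξ)² dξ )^{1/4}. -/
open MeasureTheory intervalIntegral Real Set

/-- Cauchy–Schwarz for interval integrals over `[0, 1]`, in squared form. -/
lemma sq_integral_mul_le {f g : ℝ → ℝ} (hf : ContinuousOn f (Icc 0 1))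
    (hg : ContinuousOn g (Icc 0 1)) :
    (∫ x in (0:ℝ)..1, f x * g x) ^ 2 ≤
      (∫ x in (0:ℝ)..1, f x ^ 2) * ∫ x in (0:ℝ)..1, g x ^ 2 := by
  rw [← uIcc_of_le zero_le_one] at hf hg
  have key : ∀ t : ℝ, 0 ≤ (∫ x in (0:ℝ)..1, g x ^ 2) * (t * t) +
      (-2 * ∫ x in (0:ℝ)..1, f x * g x) * t + ∫ x in (0:ℝ)..1, f x ^ 2 := by
    intro t
    have h0 : 0 ≤ ∫ x in (0:ℝ)..1, (f x - t * g x) ^ 2 :=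
      integral_nonneg zero_le_one fun x _ => sq_nonneg _
    have h1 : ∫ x in (0:ℝ)..1, (f x - t * g x) ^ 2 =
        ∫ x in (0:ℝ)..1, (t * t) * g x ^ 2 + (-2 * t) * (f x * g x) + f x ^ 2 := by
      congr 1; ext x; ring
    rw [h1, intervalIntegral.integral_add, intervalIntegral.integral_add,
      intervalIntegral.integral_const_mul, intervalIntegral.integral_const_mul] at h0
    · linarith
    all_goals exact ContinuousOn.intervalIntegrable (by fun_prop)
  have h := discrim_le_zero key
  rw [discrim] at h
  linarith

/-- Bessel's inequality on `[0, 1]` for a continuous orthonormal family. -/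
lemma sum_sq_integral_mul_le {ι : Type*} [DecidableEq ι] {f : ℝ → ℝ} {c : ι → ℝ → ℝ}
    (hf : ContinuousOn f (Icc 0 1)) (hc : ∀ i, ContinuousOn (c i) (Icc 0 1))
    (horth : ∀ i j, ∫ x in (0:ℝ)..1, c i x * c j x = if i = j then 1 else 0) (s : Finset ι) :
    ∑ i ∈ s, (∫ x in (0:ℝ)..1, f x * c i x) ^ 2 ≤ ∫ x in (0:ℝ)..1, f x ^ 2 := by
  rw [← uIcc_of_le zero_le_one] at hf hc
  set a : ι → ℝ := fun i => ∫ x in (0:ℝ)..1, f x * c i x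
  have h0 : 0 ≤ ∫ x in (0:ℝ)..1, (f x - ∑ i ∈ s, a i * c i x) ^ 2 :=
    integral_nonneg zero_le_one fun x _ => sq_nonneg _
  have h1 : ∫ x in (0:ℝ)..1, (f x - ∑ i ∈ s, a i * c i x) ^ 2 =
      ∫ x in (0:ℝ)..1, (f x ^ 2 - ∑ i ∈ s, 2 * a i * (f x * c i x)) +
        ∑ i ∈ s, ∑ j ∈ s, a i * a j * (c i x * c j x) := by
    congr 1; ext x
    have e1 : ∑ i ∈ s, 2 * a i * (f x * c i x) = 2 * f x * ∑ i ∈ s, a i * c i x := by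
      rw [Finset.mul_sum]; exact Finset.sum_congr rfl fun i _ => by ring
    have e2 : ∑ i ∈ s, ∑ j ∈ s, a i * a j * (c i x * c j x) = (∑ i ∈ s, a i * c i x) ^ 2 := by
      rw [sq, Finset.sum_mul_sum]
      exact Finset.sum_congr rfl fun i _ => Finset.sum_congr rfl fun j _ => by ring
    rw [e1, e2]; ring
  have hint : ∀ i, IntervalIntegrable (fun x => 2 * a i * (f x * c i x)) volume 0 1 := fun i =>
    ContinuousOn.intervalIntegrable (continuousOn_const.mul (hf.mul (hc i)))
  have hint2 : ∀ i j, IntervalIntegrable (fun x => a i * a j * (c i x * c j x)) volume 0 1 :=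
    fun i j => ContinuousOn.intervalIntegrable (continuousOn_const.mul ((hc i).mul (hc j)))
  have hint3 : ∀ i, IntervalIntegrable (fun x => ∑ j ∈ s, a i * a j * (c i x * c j x))
      volume 0 1 := fun i => ContinuousOn.intervalIntegrable
    (continuousOn_finsetSum _ fun j _ => continuousOn_const.mul ((hc i).mul (hc j)))
  have hintS : IntervalIntegrable (fun x => ∑ i ∈ s, 2 * a i * (f x * c i x)) volume 0 1 :=
    ContinuousOn.intervalIntegrable
      (continuousOn_finsetSum _ fun i _ => continuousOn_const.mul (hf.mul (hc i)))
  have hintT : IntervalIntegrable (fun x => ∑ i ∈ s, ∑ j ∈ s, a i * a j * (c i x * c j x))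
      volume 0 1 := ContinuousOn.intervalIntegrable
    (continuousOn_finsetSum _ fun i _ => continuousOn_finsetSum _ fun j _ =>
      continuousOn_const.mul ((hc i).mul (hc j)))
  have hf2 : IntervalIntegrable (fun x => f x ^ 2) volume 0 1 :=
    ContinuousOn.intervalIntegrable (hf.pow 2)
  have hlin : ∫ x in (0:ℝ)..1, ∑ i ∈ s, 2 * a i * (f x * c i x) = 2 * ∑ i ∈ s, a i ^ 2 := by
    rw [integral_finsetSum fun i _ => hint i, Finset.mul_sum]
    refine Finset.sum_congr rfl fun i _ => ?_
    rw [intervalIntegral.integral_const_mul, ← show a i = ∫ x in (0:ℝ)..1, f x * c i x from rfl]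
    ring
  have hquad : ∫ x in (0:ℝ)..1, ∑ i ∈ s, ∑ j ∈ s, a i * a j * (c i x * c j x) =
      ∑ i ∈ s, a i ^ 2 := by
    rw [integral_finsetSum fun i _ => hint3 i]
    refine Finset.sum_congr rfl fun i hi => ?_
    rw [integral_finsetSum fun j _ => hint2 i j]
    simp only [intervalIntegral.integral_const_mul, horth, mul_ite, mul_one, mul_zero,
      Finset.sum_ite_eq, hi, if_true, sq]
  rw [h1, intervalIntegral.integral_add (hf2.sub hintS) hintT,
    intervalIntegral.integral_sub hf2 hintS, hlin, hquad] at h0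
  linarith

lemma integral_cos_int_mul_pi {m : ℤ} (hm : m ≠ 0) :
    ∫ x in (0:ℝ)..1, cos (m * π * x) = 0 := by
  have h : (m * π : ℝ) ≠ 0 := mul_ne_zero (Int.cast_ne_zero.mpr hm) pi_ne_zero
  rw [integral_comp_mul_left (fun x => cos x) h]
  simp [sin_int_mul_pi]

/-- The functions `√2 cos (k π x)`, `k ≥ 1`, are orthonormal in `L²(0, 1)`. -/
lemma integral_sqrt_two_cos_mul (i j : ℕ) :
    ∫ x in (0:ℝ)..1, (√2 * cos (((i:ℝ) + 1) * π * x)) * (√2 * cos (((j:ℝ) + 1) * π * x)) =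
      if i = j then 1 else 0 := by
  have h : ∀ x : ℝ, (√2 * cos (((i:ℝ) + 1) * π * x)) * (√2 * cos (((j:ℝ) + 1) * π * x)) =
      cos (((i - j : ℤ) : ℝ) * π * x) + cos (((i + j + 2 : ℤ) : ℝ) * π * x) := by
    intro x
    have e1 : ((i - j : ℤ) : ℝ) * π * x = ((i:ℝ) + 1) * π * x - ((j:ℝ) + 1) * π * x := by
      push_cast; ring
    have e2 : ((i + j + 2 : ℤ) : ℝ) * π * x = ((i:ℝ) + 1) * π * x + ((j:ℝ) + 1) * π * x := by
      push_cast; ring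
    rw [e1, e2, cos_sub, cos_add]
    linear_combination (cos (((i:ℝ) + 1) * π * x) * cos (((j:ℝ) + 1) * π * x)) *
      Real.sq_sqrt (zero_le_two (α := ℝ))
  simp_rw [h]
  rw [intervalIntegral.integral_add (Continuous.intervalIntegrable (by fun_prop) _ _)
      (Continuous.intervalIntegrable (by fun_prop) _ _),
    integral_cos_int_mul_pi (m := i + j + 2) (by positivity)]
  split_ifs with hij
  · simp [hij]
  · rw [integral_cos_int_mul_pi (by omega), add_zero]

/-- The sine coefficients of the derivative of a `C¹` function vanishing at `0` and `1` are given by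
its own cosine coefficients. -/
lemma integral_derivWithin_mul_sin {f : ℝ → ℝ} (hf : ContDiffOn ℝ 1 f (Icc 0 1))
    (h0 : f 0 = 0) (h1 : f 1 = 0) (w : ℝ) :
    ∫ x in (0:ℝ)..1, derivWithin f (Icc 0 1) x * (√2 * sin (w * x)) =
      -w * ∫ x in (0:ℝ)..1, f x * (√2 * cos (w * x)) := by
  have hd : ∀ x ∈ Ioo (min 0 1 : ℝ) (max 0 1), HasDerivWithinAt f
      (derivWithin f (Icc 0 1) x) (Ioi x) x := by
    intro x hx
    simp only [zero_le_one, min_eq_left, max_eq_right] at hx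
    exact ((hf.differentiableOn one_ne_zero x
      (Ioo_subset_Icc_self hx)).hasDerivWithinAt.hasDerivAt (Icc_mem_nhds hx.1 hx.2)).hasDerivWithinAt
  have hv : ∀ x : ℝ, HasDerivAt (fun x => √2 * sin (w * x)) (√2 * (cos (w * x) * w)) x := by
    intro x
    exact (((hasDerivAt_id x).const_mul w).sin.const_mul √2).congr_deriv (by simp)
  have hfc : ContinuousOn f (uIcc 0 1) := by
    rw [uIcc_of_le zero_le_one]; exact hf.continuousOn
  have hf' : ContinuousOn (derivWithin f (Icc 0 1)) (uIcc 0 1) := by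
    rw [uIcc_of_le zero_le_one]
    exact hf.continuousOn_derivWithin (uniqueDiffOn_Icc zero_lt_one) le_rfl
  have hp := integral_deriv_mul_eq_sub_of_hasDeriv_right hfc
    (by fun_prop : ContinuousOn (fun x => √2 * sin (w * x)) (uIcc 0 1)) hd
    (fun x _ => (hv x).hasDerivWithinAt) hf'.intervalIntegrable
    (Continuous.intervalIntegrable (by fun_prop) _ _)
  rw [h0, h1, intervalIntegral.integral_add] at hp
  · have e : ∫ x in (0:ℝ)..1, f x * (√2 * (cos (w * x) * w)) =
        w * ∫ x in (0:ℝ)..1, f x * (√2 * cos (w * x)) := by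
      rw [← intervalIntegral.integral_const_mul]; congr 1; ext x; ring
    rw [e] at hp
    linarith
  · exact (hf'.mul (by fun_prop)).intervalIntegrable
  · exact (hfc.mul (by fun_prop)).intervalIntegrable

/-- Agmon's inequality on `[0, 1]`. -/
lemma sq_le_two_mul_sqrt_mul_sqrt {u : ℝ → ℝ} (hu : ContDiffOn ℝ 1 u (Icc 0 1)) (h0 : u 0 = 0)
    {x : ℝ} (hx : x ∈ Icc (0:ℝ) 1) :
    u x ^ 2 ≤ 2 * (√(∫ y in (0:ℝ)..1, u y ^ 2) *
      √(∫ y in (0:ℝ)..1, derivWithin u (Icc 0 1) y ^ 2)) := by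
  have huc := hu.continuousOn
  have hu' : ContinuousOn (derivWithin u (Icc 0 1)) (Icc 0 1) :=
    hu.continuousOn_derivWithin (uniqueDiffOn_Icc zero_lt_one) le_rfl
  have hsub : Icc 0 x ⊆ Icc (0:ℝ) 1 := Icc_subset_Icc_right hx.2
  have hgc : ContinuousOn (fun y => 2 * u y * derivWithin u (Icc 0 1) y) (Icc 0 1) := by fun_prop
  have hftc : ∫ y in (0:ℝ)..x, 2 * u y * derivWithin u (Icc 0 1) y = u x ^ 2 - u 0 ^ 2 := by
    refine integral_eq_sub_of_hasDerivAt_of_le (f := fun y => u y ^ 2) hx.1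
      ((huc.pow 2).mono hsub) (fun y hy => ?_) ?_
    · have hy' : y ∈ Ioo (0:ℝ) 1 := ⟨hy.1, hy.2.trans_le hx.2⟩
      have hd := ((hu.differentiableOn one_ne_zero) y
        (Ioo_subset_Icc_self hy')).hasDerivWithinAt.hasDerivAt (Icc_mem_nhds hy'.1 hy'.2)
      exact (hd.pow 2).congr_deriv (by simp)
    · exact ContinuousOn.intervalIntegrable (by rw [uIcc_of_le hx.1]; exact hgc.mono hsub)
  have habs : ContinuousOn (fun y => |u y| * |derivWithin u (Icc 0 1) y|) (Icc 0 1) :=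
    huc.abs.mul hu'.abs
  have hle : u x ^ 2 ≤ 2 * ∫ y in (0:ℝ)..1, |u y| * |derivWithin u (Icc 0 1) y| := by
    calc u x ^ 2 = ∫ y in (0:ℝ)..x, 2 * u y * derivWithin u (Icc 0 1) y := by
          rw [hftc, h0]; ring
      _ ≤ ∫ y in (0:ℝ)..x, 2 * (|u y| * |derivWithin u (Icc 0 1) y|) := by
          refine integral_mono_on hx.1 ?_ ?_ fun y _ => ?_
          · exact ContinuousOn.intervalIntegrable (by rw [uIcc_of_le hx.1]; exact hgc.mono hsub)
          · exact ContinuousOn.intervalIntegrable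
              (by rw [uIcc_of_le hx.1]; exact (continuousOn_const.mul habs).mono hsub)
          · rw [← abs_mul, mul_assoc]
            gcongr
            exact le_abs_self _
      _ ≤ ∫ y in (0:ℝ)..1, 2 * (|u y| * |derivWithin u (Icc 0 1) y|) := by
          refine integral_mono_interval le_rfl hx.1 hx.2
            (Filter.Eventually.of_forall fun y => by positivity) ?_
          exact ContinuousOn.intervalIntegrable
            (by rw [uIcc_of_le zero_le_one]; exact continuousOn_const.mul habs)
      _ = _ := intervalIntegral.integral_const_mul _ _
  refine hle.trans ?_
  gcongr
  have hcs := sq_integral_mul_le huc.abs hu'.abs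
  simp only [sq_abs] at hcs
  rw [← Real.sqrt_mul (integral_nonneg zero_le_one fun y _ => sq_nonneg _)]
  exact Real.le_sqrt_of_sq_le hcs

/-- The Gagliardo–Nirenberg inequality bounding the `L⁴` norm on `[0, 1]`. -/
lemma integral_sq_sq_le {u : ℝ → ℝ} (hu : ContDiffOn ℝ 1 u (Icc 0 1)) (h0 : u 0 = 0) :
    ∫ x in (0:ℝ)..1, (u x ^ 2) ^ 2 ≤ 2 * (√(∫ y in (0:ℝ)..1, u y ^ 2) *
      √(∫ y in (0:ℝ)..1, derivWithin u (Icc 0 1) y ^ 2)) * ∫ y in (0:ℝ)..1, u y ^ 2 := by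
  have huc : ContinuousOn u (uIcc 0 1) := by
    rw [uIcc_of_le zero_le_one]; exact hu.continuousOn
  rw [← intervalIntegral.integral_const_mul]
  refine integral_mono_on zero_le_one ((huc.pow 2).pow 2).intervalIntegrable
    (continuousOn_const.mul (huc.pow 2)).intervalIntegrable fun x hx => ?_
  rw [sq (u x ^ 2)]
  exact mul_le_mul_of_nonneg_right (sq_le_two_mul_sqrt_mul_sqrt hu h0 hx) (sq_nonneg _)

/-- Dual-norm bound for the Burgers nonlinearity: there is a constant `C` such
that for every continuously differentiable `u : [0,1] → ℝ` vanishing at the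
boundary, `(∑_{k≥1} ((1/(2kπ)) ∫₀¹ (u²)'(ξ) √2 sin(kπξ) dξ)²)^{1/2}
  ≤ C (∫₀¹ u²)^{3/4} (∫₀¹ (u')²)^{1/4}`. -/
theorem burgers_dual_norm_interpolation_bound :
    ∃ C : ℝ, ∀ u : ℝ → ℝ, ContDiffOn ℝ 1 u (Set.Icc 0 1) →
      u 0 = 0 → u 1 = 0 →
      Real.sqrt (∑' k : ℕ,
          ((1 / (2 * ((k:ℝ) + 1) * Real.pi)) *
            ∫ ξ in (0:ℝ)..1,
              derivWithin (fun t => u t ^ 2) (Set.Icc 0 1) ξ *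
                (Real.sqrt 2 * Real.sin (((k:ℝ) + 1) * Real.pi * ξ))) ^ 2)
        ≤ C * (∫ ξ in (0:ℝ)..1, u ξ ^ 2) ^ ((3:ℝ)/4) *
            (∫ ξ in (0:ℝ)..1, (derivWithin u (Set.Icc 0 1) ξ) ^ 2) ^ ((1:ℝ)/4) := by
  refine ⟨1, fun u hu h0 h1 => ?_⟩
  have hA : 0 ≤ ∫ y in (0:ℝ)..1, u y ^ 2 := integral_nonneg zero_le_one fun y _ => sq_nonneg _
  have hB : 0 ≤ ∫ y in (0:ℝ)..1, derivWithin u (Icc 0 1) y ^ 2 :=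
    integral_nonneg zero_le_one fun y _ => sq_nonneg _
  have hL4 := integral_sq_sq_le hu h0
  have hbessel := sum_sq_integral_mul_le (f := fun x => u x ^ 2) (hu.continuousOn.pow 2)
    (c := fun k : ℕ => fun x => √2 * cos (((k:ℝ) + 1) * π * x))
    (fun k => by fun_prop) integral_sqrt_two_cos_mul
  have hterm : ∀ k : ℕ, ((1 / (2 * ((k:ℝ) + 1) * π)) * ∫ ξ in (0:ℝ)..1,
      derivWithin (fun t => u t ^ 2) (Icc 0 1) ξ * (√2 * sin (((k:ℝ) + 1) * π * ξ))) ^ 2 =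
      (1 / 4) * (∫ x in (0:ℝ)..1, u x ^ 2 * (√2 * cos (((k:ℝ) + 1) * π * x))) ^ 2 := by
    intro k
    rw [integral_derivWithin_mul_sin (hu.pow 2) (by simp [h0]) (by simp [h1])]
    generalize (∫ x in (0:ℝ)..1, u x ^ 2 * (√2 * cos (((k:ℝ) + 1) * π * x))) = I
    have hk : (k:ℝ) + 1 ≠ 0 := by positivity
    field_simp
    ring
  simp_rw [hterm]
  set A := ∫ y in (0:ℝ)..1, u y ^ 2
  set B := ∫ y in (0:ℝ)..1, derivWithin u (Icc 0 1) y ^ 2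
  have hsum : ∑' k : ℕ, (1 / 4) *
      (∫ x in (0:ℝ)..1, u x ^ 2 * (√2 * cos (((k:ℝ) + 1) * π * x))) ^ 2 ≤ √A * √B * A := by
    refine Real.tsum_le_of_sum_range_le (fun k => by positivity) fun n => ?_
    rw [← Finset.mul_sum]
    have : 0 ≤ √A * √B * A := by positivity
    linarith [hbessel (Finset.range n)]
  refine Real.sqrt_le_iff.mpr ⟨by positivity, hsum.trans_eq ?_⟩
  rw [one_mul, mul_pow, ← Real.rpow_mul_natCast hA, ← Real.rpow_mul_natCast hB,
    Real.sqrt_eq_rpow, Real.sqrt_eq_rpow]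
  have hA' : A ^ ((3:ℝ) / 4 * (2:ℕ)) = A ^ ((1:ℝ) / 2) * A := by
    rw [← Real.rpow_add_one' hA (by norm_num)]
    norm_num
  rw [hA']
  norm_num
  ring
end

section
/- There exists a constant C such that for all continuously differentiable functions u, v : [0,1] → ℝ with u(0) = u(1) = v(0) = v(1) = 0, (1/2) ∫₀¹ (u² − v²)'(ξ) · (u(ξ) − v(ξ)) dξ ≤ (1/2) ∫₀¹ (u'(ξ) − v'(ξ))² dξ + C ( ∫₀¹ (u(ξ) − v(ξ))² dξ ) ( ∫₀¹ u'(ξ)² dξ + ∫₀¹ v'(ξ)² dξ ). -/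
open MeasureTheory intervalIntegral Real Set

/-- A primitive vanishing at `0` is bounded on `[0,1]` by the `L²` norm of its derivative. -/
theorem sq_le_integral_deriv_sq {f f' : ℝ → ℝ} (hf : ContinuousOn f (Icc 0 1))
    (hf' : ContinuousOn f' (Icc 0 1)) (hd : ∀ x ∈ Ioo (0 : ℝ) 1, HasDerivAt f (f' x) x)
    (h0 : f 0 = 0) {x : ℝ} (hx : x ∈ Icc (0 : ℝ) 1) :
    f x ^ 2 ≤ ∫ t in (0 : ℝ)..1, f' t ^ 2 := by
  have hsub : Icc 0 x ⊆ Icc (0 : ℝ) 1 := Icc_subset_Icc_right hx.2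
  have hci : ContinuousOn f' (uIcc 0 x) := by
    rw [uIcc_of_le hx.1]; exact hf'.mono hsub
  have hint : IntervalIntegrable f' volume 0 x := hci.intervalIntegrable
  have hint2 : IntervalIntegrable (fun t => f' t ^ 2) volume 0 x :=
    (hci.pow 2).intervalIntegrable
  have hftc : ∫ t in (0 : ℝ)..x, f' t = f x - f 0 :=
    integral_eq_sub_of_hasDerivAt_of_le hx.1 (hf.mono hsub)
      (fun t ht => hd t ⟨ht.1, ht.2.trans_le hx.2⟩) hint
  have hnonneg : 0 ≤ ∫ t in (0 : ℝ)..x, (f' t - f x) ^ 2 :=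
    integral_nonneg hx.1 fun t _ => sq_nonneg _
  have hexp : ∫ t in (0 : ℝ)..x, (f' t - f x) ^ 2
      = (∫ t in (0 : ℝ)..x, f' t ^ 2) - 2 * f x * f x + x * f x ^ 2 := by
    have : ∀ t, (f' t - f x) ^ 2 = f' t ^ 2 - 2 * f x * f' t + f x ^ 2 := fun t => by ring
    simp only [this]
    rw [integral_add (hint2.sub (hint.const_mul _)) intervalIntegrable_const,
      integral_sub hint2 (hint.const_mul _), intervalIntegral.integral_const_mul, hftc, h0,
      intervalIntegral.integral_const]
    simp
  have hmono : ∫ t in (0 : ℝ)..x, f' t ^ 2 ≤ ∫ t in (0 : ℝ)..1, f' t ^ 2 := by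
    refine integral_mono_interval le_rfl hx.1 hx.2
      (Filter.Eventually.of_forall fun t => sq_nonneg _) ?_
    refine ContinuousOn.intervalIntegrable ?_
    rw [uIcc_of_le zero_le_one]
    exact hf'.pow 2
  nlinarith [mul_nonneg (sub_nonneg.2 hx.2) (sq_nonneg (f x))]

/-- Local monotonicity of the Burgers nonlinearity: there is a constant `C`
such that for all continuously differentiable `u, v : [0,1] → ℝ` vanishing at
the boundary,
`(1/2) ∫₀¹ (u² - v²)' (u - v) ≤ (1/2) ∫₀¹ (u' - v')²
  + C (∫₀¹ (u - v)²) (∫₀¹ (u')² + ∫₀¹ (v')²)`. -/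
theorem burgers_local_monotonicity :
    ∃ C : ℝ, ∀ u v : ℝ → ℝ,
      ContDiffOn ℝ 1 u (Set.Icc 0 1) → ContDiffOn ℝ 1 v (Set.Icc 0 1) →
      u 0 = 0 → u 1 = 0 → v 0 = 0 → v 1 = 0 →
      (1/2) * (∫ ξ in (0:ℝ)..1,
          derivWithin (fun t => u t ^ 2 - v t ^ 2) (Set.Icc 0 1) ξ * (u ξ - v ξ))
        ≤ (1/2) * (∫ ξ in (0:ℝ)..1,
              (derivWithin u (Set.Icc 0 1) ξ - derivWithin v (Set.Icc 0 1) ξ) ^ 2)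
          + C * (∫ ξ in (0:ℝ)..1, (u ξ - v ξ) ^ 2) *
              ((∫ ξ in (0:ℝ)..1, (derivWithin u (Set.Icc 0 1) ξ) ^ 2)
                + (∫ ξ in (0:ℝ)..1, (derivWithin v (Set.Icc 0 1) ξ) ^ 2)) := by
  refine ⟨1 / 4, fun u v hu hv hu0 hu1 hv0 hv1 => ?_⟩
  have huniq : UniqueDiffOn ℝ (Icc (0 : ℝ) 1) := uniqueDiffOn_Icc zero_lt_one
  have hU := hu.continuousOn_derivWithin huniq le_rfl
  have hV := hv.continuousOn_derivWithin huniq le_rfl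
  have hdu : ∀ x ∈ Icc (0 : ℝ) 1, HasDerivWithinAt u (derivWithin u (Icc 0 1) x) (Icc 0 1) x :=
    fun x hx => (hu.differentiableOn one_ne_zero x hx).hasDerivWithinAt
  have hdv : ∀ x ∈ Icc (0 : ℝ) 1, HasDerivWithinAt v (derivWithin v (Icc 0 1) x) (Icc 0 1) x :=
    fun x hx => (hv.differentiableOn one_ne_zero x hx).hasDerivWithinAt
  have hsq : ∀ x ∈ Icc (0 : ℝ) 1, derivWithin (fun t => u t ^ 2 - v t ^ 2) (Icc 0 1) x
      = 2 * u x * derivWithin u (Icc 0 1) x - 2 * v x * derivWithin v (Icc 0 1) x := by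
    intro x hx
    rw [(((hdu x hx).fun_pow 2).fun_sub ((hdv x hx).fun_pow 2)).derivWithin (huniq x hx)]
    norm_num
  have hcu := hu.continuousOn
  have hcv := hv.continuousOn
  generalize derivWithin u (Icc 0 1) = U at *
  generalize derivWithin v (Icc 0 1) = V at *
  have hdu' : ∀ x ∈ Ioo (0 : ℝ) 1, HasDerivAt u (U x) x := fun x hx =>
    (hdu x (Ioo_subset_Icc_self hx)).hasDerivAt (Icc_mem_nhds hx.1 hx.2)
  have hdv' : ∀ x ∈ Ioo (0 : ℝ) 1, HasDerivAt v (V x) x := fun x hx =>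
    (hdv x (Ioo_subset_Icc_self hx)).hasDerivAt (Icc_mem_nhds hx.1 hx.2)
  have hii : ∀ {g : ℝ → ℝ}, ContinuousOn g (Icc 0 1) → IntervalIntegrable g volume 0 1 := by
    intro g hg
    refine ContinuousOn.intervalIntegrable ?_
    rwa [uIcc_of_le zero_le_one]
  have hlhs : ∫ ξ in (0 : ℝ)..1, derivWithin (fun t => u t ^ 2 - v t ^ 2) (Icc 0 1) ξ * (u ξ - v ξ)
      = ∫ ξ in (0 : ℝ)..1, (2 * u ξ * U ξ - 2 * v ξ * V ξ) * (u ξ - v ξ) := by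
    refine integral_congr fun x hx => ?_
    rw [uIcc_of_le zero_le_one] at hx
    simp only [hsq x hx]
  rw [hlhs]
  set M := ∫ ξ in (0 : ℝ)..1, (U ξ + V ξ) ^ 2
  have hsup : ∀ x ∈ Icc (0 : ℝ) 1, (u x + v x) ^ 2 ≤ M := fun x hx =>
    sq_le_integral_deriv_sq (f := fun t => u t + v t) (f' := fun t => U t + V t)
      (hcu.add hcv) (hU.add hV)
      (fun t ht => (hdu' t ht).fun_add (hdv' t ht)) (by simp [hu0, hv0]) hx
  have hMle : M ≤ 2 * ((∫ ξ in (0 : ℝ)..1, U ξ ^ 2) + ∫ ξ in (0 : ℝ)..1, V ξ ^ 2) := by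
    rw [← integral_add (hii (hU.fun_pow 2)) (hii (hV.fun_pow 2)),
      ← intervalIntegral.integral_const_mul]
    refine integral_mono_on zero_le_one (hii (by fun_prop)) (hii (by fun_prop)) fun x _ => ?_
    nlinarith [sq_nonneg (U x - V x)]
  have hboundary : ∫ ξ in (0 : ℝ)..1,
      ((U ξ + V ξ) * (u ξ - v ξ) ^ 2 + 2 * (u ξ + v ξ) * (u ξ - v ξ) * (U ξ - V ξ)) = 0 := by
    rw [integral_eq_sub_of_hasDerivAt_of_le (f := fun t => (u t + v t) * (u t - v t) ^ 2)
      zero_le_one (by fun_prop) (fun t ht => ?_) (hii (by fun_prop))]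
    · simp [hu0, hu1, hv0, hv1]
    · refine (((hdu' t ht).fun_add (hdv' t ht)).fun_mul
        (((hdu' t ht).fun_sub (hdv' t ht)).fun_pow 2)).congr_deriv ?_
      norm_num
      ring
  have hkey : ∫ ξ in (0 : ℝ)..1, (1 / 2) * ((2 * u ξ * U ξ - 2 * v ξ * V ξ) * (u ξ - v ξ))
      ≤ ∫ ξ in (0 : ℝ)..1, ((1 / 2) * (U ξ - V ξ) ^ 2 + M / 8 * (u ξ - v ξ) ^ 2
        + (1 / 2) * ((U ξ + V ξ) * (u ξ - v ξ) ^ 2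
          + 2 * (u ξ + v ξ) * (u ξ - v ξ) * (U ξ - V ξ))) := by
    refine integral_mono_on zero_le_one (hii (by fun_prop)) (hii (by fun_prop)) fun x hx => ?_
    nlinarith [mul_nonneg (sub_nonneg.2 (hsup x hx)) (sq_nonneg (u x - v x)),
      sq_nonneg (2 * (U x - V x) + (u x + v x) * (u x - v x))]
  rw [integral_add (hii (by fun_prop)) (hii (by fun_prop)),
    integral_add (hii (by fun_prop)) (hii (by fun_prop))] at hkey
  simp only [intervalIntegral.integral_const_mul] at hkey
  rw [hboundary] at hkey
  have hw : 0 ≤ ∫ ξ in (0 : ℝ)..1, (u ξ - v ξ) ^ 2 :=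
    integral_nonneg zero_le_one fun t _ => sq_nonneg _
  nlinarith [mul_le_mul_of_nonneg_left hMle hw]
end
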